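/- Assume in addition that A^× = 𝔽_q^×. Let N be a nonzero proper ideal of A, m := dim_{𝔽_q}(A/N), and let R ⊆ N^{−1}L∖L contain exactly one element of each equivalence class for the relation v ∼ w ⟺ w ∈ αv + L for some α ∈ 𝔽_q^×. Then for every γ ∈ GL_r(F) with Lγ = L and every ω ∈ K^r with ω_1,…,ω_r linearly independent over F_∞, one has ∏_{v∈R} e_{Lω}((vγ)ω) = (det γ)^m · ∏_{v∈R} e_{Lω}(vω), where det γ ∈ A^× = 𝔽_q^× ⊆ K. (Key identity in the proof of Proposition 16.8(b).) -/

import Mathlib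

open scoped BigOperators

/-- The pairing of a row vector `x` with a column vector `ω`: `xω = ∑ i, x i * ω i`. -/
noncomputable def rvPair {K : Type*} [Field K] {r : ℕ} (x ω : Fin r → K) : K :=
  ∑ i, x i * ω i

/-- A subset `M` of a seminormed additive group is strongly discrete if `M ∩ B` is finite
for every bounded subset `B`. -/
def StronglyDiscrete {E : Type*} [SeminormedAddCommGroup E] (M : Set E) : Prop :=
  ∀ B : Set E, Bornology.IsBounded B → (M ∩ B).Finite

/-- The exponential function `e_Λ(z) = z·∏_{λ ∈ Λ, λ ≠ 0} (1 - z/λ)` of a subset `Λ ⊆ K`. -/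
noncomputable def expF {K : Type*} [NormedField K] (Λ : Set K) (z : K) : K :=
  z * ∏' l : {l : K // l ∈ Λ ∧ l ≠ 0}, (1 - z / (l : K))

/-- `a⁻¹L = {x : a•x ∈ L}`. -/
def invSc {K : Type*} [Field K] {r : ℕ} (a : K) (L : Set (Fin r → K)) : Set (Fin r → K) :=
  {x | a • x ∈ L}

/-- `N⁻¹L = {x : b•x ∈ L for all b ∈ N}`, for an ideal `N` of a subring `A ⊆ K`. -/
def invIdl {K : Type*} [Field K] {A : Subring K} {r : ℕ} (N : Ideal A)
    (L : Set (Fin r → K)) : Set (Fin r → K) :=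
  {x | ∀ b : A, b ∈ N → (b : K) • x ∈ L}

/-- `R` contains exactly one element of each coset of `L` in `S` other than `L` itself. -/
def IsRepSet {K : Type*} [Field K] {r : ℕ} (L S : Set (Fin r → K))
    (R : Finset (Fin r → K)) : Prop :=
  (R : Set (Fin r → K)) ⊆ S \ L ∧ ∀ x ∈ S, x ∉ L → ∃! y, y ∈ R ∧ x - y ∈ L

/-- The discriminant value `a · ∏_{w ∈ R} e_{Lω}(wω)⁻¹`. -/
noncomputable def discVal {K : Type*} [NormedField K] {r : ℕ} (a : K)
    (L : Set (Fin r → K)) (R : Finset (Fin r → K)) (ω : Fin r → K) : K :=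
  a * ∏ w ∈ R, (expF ((fun x => rvPair x ω) '' L) (rvPair w ω))⁻¹

section Transfer

variable {k ι : Type*} [Field k]

/-- A family `u b`, `b ∈ R`, representing every line of `V` exactly once. -/
def RepresentsLines {β V : Type*} (k : Type*) [Field k] [AddCommGroup V] [Module k V]
    (R : Finset β) (u : β → V) : Prop :=
  (∀ b ∈ R, u b ≠ 0) ∧ ∀ v : V, v ≠ 0 → ∃! b, b ∈ R ∧ ∃ c : k, c ≠ 0 ∧ v = c • u b

theorem RepresentsLines.prod_eq {β V K : Type*} [AddCommGroup V] [Module k V] [Fintype V]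
    [Field K] [Algebra k K] {R : Finset β} {u : β → V} (hR : RepresentsLines k R u)
    (h : V → k) (h_ne : ∀ v, v ≠ 0 → h v ≠ 0) (h_smul : ∀ (c : k) v, c ≠ 0 → h (c • v) = c * h v)
    (f : V → K) (hf : ∀ (c : k) v, c ≠ 0 → f (c • v) = algebraMap k K c * f v)
    [DecidablePred fun v : V => v ≠ 0 ∧ h v = 1] :
    ∏ b ∈ R, f (u b) = (∏ b ∈ R, algebraMap k K (h (u b))) *
      ∏ v ∈ Finset.univ.filter (fun v : V => v ≠ 0 ∧ h v = 1), f v := by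
  have h1 : ∏ v ∈ Finset.univ.filter (fun v : V => v ≠ 0 ∧ h v = 1), f v =
      ∏ b ∈ R, f ((h (u b))⁻¹ • u b) := by
    symm
    refine Finset.prod_bij (fun b _ => (h (u b))⁻¹ • u b) ?_ ?_ ?_ (fun _ _ => rfl)
    · intro b hb
      have h0 := h_ne _ (hR.1 b hb)
      simp [h0, hR.1 b hb, h_smul]
    · intro b hb b' hb' e
      have h0 := h_ne _ (hR.1 b hb)
      have h0' := h_ne _ (hR.1 b' hb')
      refine (hR.2 (u b) (hR.1 b hb)).unique ⟨hb, 1, one_ne_zero, (one_smul _ _).symm⟩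
        ⟨hb', h (u b) * (h (u b'))⁻¹, by simp [h0, h0'], ?_⟩
      rw [mul_smul, ← e, smul_smul, mul_inv_cancel₀ h0, one_smul]
    · intro v hv
      simp only [Finset.mem_filter, Finset.mem_univ, true_and] at hv
      obtain ⟨b, ⟨hb, c, hc, e⟩, -⟩ := hR.2 v hv.1
      have h0 := h_ne _ (hR.1 b hb)
      refine ⟨b, hb, ?_⟩
      have h2 : c * h (u b) = 1 := by rw [← h_smul _ _ hc, ← e, hv.2]
      show (h (u b))⁻¹ • u b = v
      rw [e, eq_inv_of_mul_eq_one_left h2]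
  rw [h1, ← Finset.prod_mul_distrib]
  refine Finset.prod_congr rfl fun b hb => ?_
  have h0 := h_ne _ (hR.1 b hb)
  rw [hf _ _ (inv_ne_zero h0), ← mul_assoc, ← map_mul, mul_inv_cancel₀ h0, map_one, one_mul]

/-- Every vector space of functions carries a nowhere vanishing homogeneous function. -/
theorem exists_homogeneous_ne_zero (k ι : Type*) [Field k] :
    ∃ h : (ι → k) → k, (∀ v, v ≠ 0 → h v ≠ 0) ∧
      ∀ (c : k) v, c ≠ 0 → h (c • v) = c * h v := by
  classical
  have : ∀ s : Set ι, ∃ F : (ι → k) → k, (s.Nonempty → ∃ i ∈ s, ∀ v, F v = v i) ∧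
      (¬ s.Nonempty → F = 0) := by
    intro s
    by_cases hs : s.Nonempty
    · obtain ⟨i, hi⟩ := hs
      exact ⟨fun v => v i, fun _ => ⟨i, hi, fun _ => rfl⟩, fun h => (h ⟨i, hi⟩).elim⟩
    · exact ⟨0, fun h => (hs h).elim, fun _ => rfl⟩
  choose F hF hF0 using this
  refine ⟨fun v => F (Function.support v) v, fun v hv => ?_, fun c v hc => ?_⟩
  · obtain ⟨i, hi, h⟩ := hF _ (Function.support_nonempty_iff.mpr hv)
    exact (h v).trans_ne hi
  · have : Function.support (c • v) = Function.support v := by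
      ext i; simp [hc]
    simp only [this]
    by_cases hs : (Function.support v).Nonempty
    · obtain ⟨i, hi, h⟩ := hF _ hs
      simp [h]
    · simp [hF0 _ hs]

variable [Fintype ι] [DecidableEq ι]

theorem mulVec_ne_zero_iff_of_det_ne_zero {M : Matrix ι ι k} (hM : M.det ≠ 0) (v : ι → k) :
    M.mulVec v ≠ 0 ↔ v ≠ 0 := by
  have hinj : Function.Injective M.mulVec :=
    Matrix.mulVec_injective_of_isUnit ((Matrix.isUnit_iff_isUnit_det _).mpr hM.isUnit)
  rw [← Matrix.mulVec_zero M, hinj.ne_iff, Matrix.mulVec_zero]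

variable [Fintype k] {K : Type*} [Field K]

theorem prod_comp_mulVec_of_mem_iff {M : Matrix ι ι k} (hM : M.det ≠ 0) (S : Finset (ι → k))
    (hS : ∀ v, v ∈ S ↔ M.mulVec v ∈ S) (f : (ι → k) → K) :
    ∏ v ∈ S, f (M.mulVec v) = ∏ v ∈ S, f v := by
  have hinj : Function.Injective M.mulVec :=
    Matrix.mulVec_injective_of_isUnit ((Matrix.isUnit_iff_isUnit_det _).mpr hM.isUnit)
  exact Finset.prod_equiv (Equiv.ofBijective _ (Finite.injective_iff_bijective.mp hinj)) hS
    (fun _ _ => rfl)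

open Classical in
/-- The vectors normalised by `h`. -/
noncomputable def unitVectors (h : (ι → k) → k) : Finset (ι → k) :=
  Finset.univ.filter fun v => v ≠ 0 ∧ h v = 1

/-- `M` multiplies products of homogeneous functions over representatives of lines by `det M`. -/
def TransfersDet (K : Type*) [Field K] [Algebra k K] (M : Matrix ι ι k) : Prop :=
  ∃ h : (ι → k) → k, (∀ v, v ≠ 0 → h v ≠ 0) ∧ (∀ (c : k) v, c ≠ 0 → h (c • v) = c * h v) ∧
    ∀ f : (ι → k) → K, (∀ (c : k) v, c ≠ 0 → f (c • v) = algebraMap k K c * f v) →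
      ∏ v ∈ unitVectors h, f (M.mulVec v) = algebraMap k K M.det * ∏ v ∈ unitVectors h, f v

theorem representsLines_unitVectors {h : (ι → k) → k} (h_ne : ∀ v, v ≠ 0 → h v ≠ 0)
    (h_smul : ∀ (c : k) v, c ≠ 0 → h (c • v) = c * h v) :
    RepresentsLines k (unitVectors h) id := by
  refine ⟨fun b hb => ?_, fun v hv => ⟨(h v)⁻¹ • v, ⟨?_, h v, h_ne v hv, ?_⟩, ?_⟩⟩
  · simp only [unitVectors, Finset.mem_filter] at hb
    exact hb.2.1
  · simp [unitVectors, hv, h_ne v hv, h_smul]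
  · simp [smul_smul, h_ne v hv]
  · rintro y ⟨hy, c, hc, e⟩
    simp only [unitVectors, Finset.mem_filter] at hy
    have : h v = c := by rw [e, id, h_smul _ _ hc, hy.2.2, mul_one]
    rw [this, e, id, inv_smul_smul₀ hc]

variable [Algebra k K]

theorem TransfersDet.prod_eq {M : Matrix ι ι k} (hM : TransfersDet K M) {β : Type*}
    {R : Finset β} {u : β → ι → k} (hR : RepresentsLines k R u) (f : (ι → k) → K)
    (hf : ∀ (c : k) v, c ≠ 0 → f (c • v) = algebraMap k K c * f v) :
    ∏ b ∈ R, f (M.mulVec (u b)) = algebraMap k K M.det * ∏ b ∈ R, f (u b) := by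
  classical
  obtain ⟨h, h_ne, h_smul, H⟩ := hM
  have h1 := hR.prod_eq h h_ne h_smul f hf
  have h2 := hR.prod_eq h h_ne h_smul (fun v => f (M.mulVec v))
    (fun c v hc => by rw [Matrix.mulVec_smul, hf c _ hc])
  have h3 := H f hf
  unfold unitVectors at h3
  rw [h1, h2]
  simp only [ne_eq] at h3 ⊢
  convert congrArg (fun t => (∏ b ∈ R, algebraMap k K (h (u b))) * t) h3 using 1
  ring

theorem TransfersDet.mul {M M' : Matrix ι ι k} (hM : TransfersDet K M)
    (hM' : TransfersDet K M') : TransfersDet K (M * M') := by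
  obtain ⟨h, h_ne, h_smul, H⟩ := id hM'
  refine ⟨h, h_ne, h_smul, fun f hf => ?_⟩
  have h2 := H (fun v => f (M.mulVec v)) (fun c v hc => by rw [Matrix.mulVec_smul, hf c _ hc])
  have h3 := hM.prod_eq (representsLines_unitVectors h_ne h_smul) f hf
  simp only [Matrix.mulVec_mulVec, id] at h2 h3
  rw [h2, h3, Matrix.det_mul, map_mul]
  ring

theorem transfersDet_transvection (t : Matrix.TransvectionStruct ι k) :
    TransfersDet K t.toMatrix := by
  classical
  obtain ⟨i, j, hij, c⟩ := t
  obtain ⟨h, h_ne, h_smul⟩ := exists_homogeneous_ne_zero k ι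
  have hv : ∀ v : ι → k, (Matrix.transvection i j c).mulVec v = v + Pi.single i (c * v j) := by
    intro v
    simp [Matrix.transvection, Matrix.add_mulVec, Matrix.single_mulVec, Pi.single]
  have hdet : (Matrix.transvection i j c).det ≠ 0 := by
    simp [Matrix.det_transvection_of_ne i j hij]
  let h' : (ι → k) → k := fun v => if v j = 0 then h v else v j
  refine ⟨h', fun v hv => ?_, fun a v ha => ?_, fun f hf => ?_⟩
  · by_cases hj : v j = 0
    · simpa [h', hj] using h_ne v hv
    · simp [h', hj]
  · by_cases hj : v j = 0
    · simp [h', hj, h_smul a v ha]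
    · simp [h', hj, ha]
  · simp only [Matrix.TransvectionStruct.toMatrix_mk, Matrix.det_transvection_of_ne i j hij,
      map_one, one_mul]
    refine prod_comp_mulVec_of_mem_iff hdet _ (fun v => ?_) f
    have h1 : h' ((Matrix.transvection i j c).mulVec v) = h' v := by
      rw [hv]
      by_cases hj : v j = 0
      · simp [h', hj]
      · simp [h', hj, Pi.single_eq_of_ne hij.symm]
    simp only [unitVectors, Finset.mem_filter, Finset.mem_univ, true_and, h1,
      mulVec_ne_zero_iff_of_det_ne_zero hdet]

theorem transfersDet_diagonal_update (i : ι) {d : k} (hd : d ≠ 0) :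
    TransfersDet K (Matrix.diagonal (Function.update (1 : ι → k) i d)) := by
  classical
  obtain ⟨h, h_ne, h_smul⟩ := exists_homogeneous_ne_zero k ι
  set M := Matrix.diagonal (Function.update (1 : ι → k) i d) with hMdef
  have hdet' : M.det = d := by
    rw [hMdef, Matrix.det_diagonal, Finset.prod_update_of_mem (Finset.mem_univ i)]
    simp
  have hdet : M.det ≠ 0 := hdet'.trans_ne hd
  have hsingle : M.mulVec (Pi.single i 1) = d • Pi.single i 1 := by
    ext l
    rw [hMdef, Matrix.mulVec_diagonal]
    by_cases hl : l = i
    · subst hl; simp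
    · simp [Pi.single_eq_of_ne hl]
  have hupd : ∀ v, Function.update (M.mulVec v) i 0 = Function.update v i 0 := by
    intro v
    ext l
    by_cases hl : l = i
    · subst hl; simp
    · simp [hl, hMdef, Matrix.mulVec_diagonal]
  have hupd_smul : ∀ (a : k) v, Function.update (a • v) i 0 = a • Function.update v i 0 := by
    intro a v
    ext l
    by_cases hl : l = i
    · subst hl; simp
    · simp [hl]
  have hupd0 : ∀ v : ι → k, Function.update v i 0 = 0 → v = v i • Pi.single i 1 := by
    intro v hv
    ext l
    by_cases hl : l = i
    · subst hl; simp
    · simpa [hl] using congrFun hv l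
  let h' : (ι → k) → k := fun v =>
    if Function.update v i 0 = 0 then v i else h (Function.update v i 0)
  refine ⟨h', fun v hv => ?_, fun a v ha => ?_, fun f hf => ?_⟩
  · by_cases hj : Function.update v i 0 = 0
    · simp only [h', hj, if_true]
      intro h0
      apply hv
      rw [hupd0 v hj, h0, zero_smul]
    · simpa [h', hj] using h_ne _ hj
  · by_cases hj : Function.update v i 0 = 0
    · simp [h', hupd_smul, hj]
    · simp [h', hupd_smul, hj, ha, h_smul]
  · have hmem : (Pi.single i 1 : ι → k) ∈ unitVectors h' := by
      have : Function.update (Pi.single i 1 : ι → k) i 0 = 0 := by simp [Pi.single]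
      simp [unitVectors, h', this]
    have hrest : ∀ v, v ∈ (unitVectors h').erase (Pi.single i 1) ↔
        Function.update v i 0 ≠ 0 ∧ h (Function.update v i 0) = 1 := by
      intro v
      simp only [Finset.mem_erase, unitVectors, Finset.mem_filter, Finset.mem_univ, true_and]
      by_cases hj : Function.update v i 0 = 0
      · simp only [h', hj, if_true, ne_eq, not_true, false_and, iff_false]
        rintro ⟨h1, -, h2⟩
        apply h1
        rw [hupd0 v hj, h2, one_smul]
      · simp only [h', hj, if_false, ne_eq, not_false_eq_true, true_and]
        refine ⟨fun H => H.2.2, fun H => ⟨?_, ?_, H⟩⟩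
        · rintro rfl
          exact hj (by simp [Pi.single])
        · rintro rfl
          exact hj (by simp)
    rw [← Finset.mul_prod_erase _ _ hmem, ← Finset.mul_prod_erase _ f hmem, hsingle, hf d _ hd,
      prod_comp_mulVec_of_mem_iff hdet _ (fun v => ?_) f, hdet', mul_assoc]
    rw [hrest, hrest, hupd]

theorem transfersDet_one : TransfersDet K (1 : Matrix ι ι k) := by
  obtain ⟨h, h_ne, h_smul⟩ := exists_homogeneous_ne_zero k ι
  exact ⟨h, h_ne, h_smul, fun f _ => by simp⟩

theorem transfersDet_diagonal (D : ι → k) (hD : ∀ i, D i ≠ 0) :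
    TransfersDet K (Matrix.diagonal D) := by
  have : ∀ s : Finset ι, TransfersDet K (Matrix.diagonal fun i => if i ∈ s then D i else 1) := by
    intro s
    induction s using Finset.induction_on with
    | empty => simpa using transfersDet_one
    | insert a s ha ih =>
      convert (transfersDet_diagonal_update a (hD a)).mul ih using 1
      rw [Matrix.diagonal_mul_diagonal]
      congr 1
      ext i
      by_cases hi : i = a
      · subst hi; simp [ha]
      · simp [hi]
  simpa using this Finset.univ

theorem transfersDet_of_det_ne_zero (M : Matrix ι ι k) (hM : M.det ≠ 0) : TransfersDet K M := by
  refine Matrix.diagonal_transvection_induction_of_det_ne_zero _ M hM (fun D hD => ?_)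
    transfersDet_transvection (fun _ _ _ _ => TransfersDet.mul)
  rw [Matrix.det_diagonal, Finset.prod_ne_zero_iff] at hD
  exact transfersDet_diagonal D fun i => hD i (Finset.mem_univ i)

/-- If `u b`, `b ∈ R`, represents every line of `V` once and `f` is homogeneous on `V`, then
composing with an automorphism `g` multiplies `∏ f (u b)` by `det g`. -/
theorem RepresentsLines.prod_comp_linearMap {k V K β : Type*} [Field k] [Finite k]
    [AddCommGroup V] [Module k V] [FiniteDimensional k V] [Field K] [Algebra k K]
    {R : Finset β} {u : β → V} (hR : RepresentsLines k R u) (g : V →ₗ[k] V)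
    (hg : LinearMap.det g ≠ 0) (f : V → K)
    (hf : ∀ (c : k) v, c ≠ 0 → f (c • v) = algebraMap k K c * f v) :
    ∏ b ∈ R, f (g (u b)) = algebraMap k K (LinearMap.det g) * ∏ b ∈ R, f (u b) := by
  classical
  have := Fintype.ofFinite k
  let B := Module.finBasis k V
  have hM : (LinearMap.toMatrix B B g).det ≠ 0 := by rwa [LinearMap.det_toMatrix]
  have hR' : RepresentsLines k R fun b => B.equivFun (u b) := by
    refine ⟨fun b hb => by simpa using hR.1 b hb, fun v hv => ?_⟩
    have h1 := hR.2 (B.equivFun.symm v) (by rwa [ne_eq, LinearEquiv.map_eq_zero_iff])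
    simpa only [LinearEquiv.symm_apply_eq, map_smul] using h1
  have h1 := (transfersDet_of_det_ne_zero (K := K) _ hM).prod_eq hR'
    (fun v => f (B.equivFun.symm v)) (fun c v hc => by rw [map_smul, hf c _ hc])
  rw [LinearMap.det_toMatrix] at h1
  have h2 : ∀ v, B.equivFun.symm ((LinearMap.toMatrix B B g).mulVec (B.equivFun v)) = g v := by
    intro v
    rw [LinearEquiv.symm_apply_eq]
    exact LinearMap.toMatrix_mulVec_repr B B g v
  simpa only [h2, LinearEquiv.symm_apply_apply] using h1

end Transfer

section Exponential

variable {K : Type*} [NontriviallyNormedField K]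

/-- `e_Λ(αz) = α e_Λ(z)` if `αΛ = Λ`. -/
theorem expF_mul {Λ : Set K} {α : K} (hα : α ≠ 0) (hΛ : ∀ l, α * l ∈ Λ ↔ l ∈ Λ) (z : K) :
    expF Λ (α * z) = α * expF Λ z := by
  unfold expF
  let e : {l : K // l ∈ Λ ∧ l ≠ 0} ≃ {l : K // l ∈ Λ ∧ l ≠ 0} :=
    (Equiv.mulLeft₀ α hα).subtypeEquiv fun l => by simp [hΛ, hα]
  rw [← e.tprod_eq, mul_assoc]
  congr 2
  refine tprod_congr fun l => ?_
  have : ((e l : {l : K // l ∈ Λ ∧ l ≠ 0}) : K) = α * l := rfl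
  rw [this, mul_div_mul_left _ _ hα]

theorem StronglyDiscrete.finite_norm_le {Λ : Set K} (h : StronglyDiscrete Λ) (c : ℝ) :
    {l | l ∈ Λ ∧ ‖l‖ ≤ c}.Finite := by
  refine (h _ (Metric.isBounded_closedBall (x := (0 : K)) (r := c))).subset ?_
  rintro l ⟨h1, h2⟩
  exact ⟨h1, by simpa using h2⟩

variable [IsUltrametricDist K]

theorem norm_sub_le_max_norm (x y : K) : ‖x - y‖ ≤ max ‖x‖ ‖y‖ := by
  simpa [sub_eq_add_neg] using IsUltrametricDist.norm_add_le_max x (-y)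

theorem norm_prod_one_sub_sub_one_le {ι : Type*} (s : Finset ι) (x : ι → K) {ε : ℝ}
    (hε : 0 ≤ ε) (hε1 : ε ≤ 1) (hx : ∀ i ∈ s, ‖x i‖ ≤ ε) : ‖∏ i ∈ s, (1 - x i) - 1‖ ≤ ε := by
  classical
  induction s using Finset.induction_on with
  | empty => simpa using hε
  | insert a s ha ih =>
    have h1 := ih fun i hi => hx i (Finset.mem_insert_of_mem hi)
    have h2 := hx a (Finset.mem_insert_self a s)
    have h3 : ‖∏ i ∈ s, (1 - x i)‖ ≤ 1 := by
      have : ∏ i ∈ s, (1 - x i) = (∏ i ∈ s, (1 - x i) - 1) + 1 := by ring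
      rw [this]
      refine (IsUltrametricDist.norm_add_le_max _ _).trans (max_le (h1.trans hε1) (by simp))
    rw [Finset.prod_insert ha]
    have : (1 - x a) * ∏ i ∈ s, (1 - x i) - 1 =
        (∏ i ∈ s, (1 - x i) - 1) - x a * ∏ i ∈ s, (1 - x i) := by ring
    rw [this]
    refine (norm_sub_le_max_norm _ _).trans (max_le h1 ?_)
    rw [norm_mul]
    exact (mul_le_of_le_one_right (norm_nonneg _) h3).trans h2

theorem multipliable_one_sub_of_finite_norm_gt [CompleteSpace K] {ι : Type*} (x : ι → K)
    (hx : ∀ ε : ℝ, 0 < ε → {i | ε < ‖x i‖}.Finite) : Multipliable fun i => 1 - x i := by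
  classical
  have hc : CauchySeq fun s : Finset ι => ∏ i ∈ s, (1 - x i) := by
    rw [Metric.cauchySeq_iff']
    intro ε hε
    let S := (hx 1 one_pos).toFinset
    set P := ∏ i ∈ S, (1 - x i) with hP
    let δ := min 1 (ε / (2 * (‖P‖ + 1)))
    have hP0 : 0 < ‖P‖ + 1 := by positivity
    have hδ : 0 < δ := by positivity
    let T := S ∪ (hx δ hδ).toFinset
    refine ⟨T, fun U hU => ?_⟩
    have h1 : ∏ i ∈ T, (1 - x i) = P * ∏ i ∈ T \ S, (1 - x i) := by
      rw [mul_comm, hP, Finset.prod_sdiff Finset.subset_union_left]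
    have h2 : ‖∏ i ∈ T, (1 - x i)‖ ≤ ‖P‖ := by
      rw [h1, norm_mul]
      refine mul_le_of_le_one_right (norm_nonneg _) ?_
      rw [norm_prod]
      refine Finset.prod_le_one (fun _ _ => norm_nonneg _) fun i hi => ?_
      have : ‖x i‖ ≤ 1 := by
        have := (Finset.mem_sdiff.mp hi).2
        simpa [S] using this
      exact (norm_sub_le_max_norm _ _).trans (max_le (by simp) this)
    have h3 : ‖∏ i ∈ U \ T, (1 - x i) - 1‖ ≤ δ := by
      refine norm_prod_one_sub_sub_one_le _ _ hδ.le (min_le_left _ _) fun i hi => ?_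
      have := (Finset.mem_sdiff.mp hi).2
      have := (not_or.mp (Finset.mem_union.not.mp this)).2
      simpa using this
    rw [dist_eq_norm, ← Finset.prod_sdiff hU]
    have : (∏ i ∈ U \ T, (1 - x i)) * ∏ i ∈ T, (1 - x i) - ∏ i ∈ T, (1 - x i) =
      (∏ i ∈ U \ T, (1 - x i) - 1) * ∏ i ∈ T, (1 - x i) := by ring
    rw [this, norm_mul]
    calc _ ≤ (ε / (2 * (‖P‖ + 1))) * ‖P‖ := by
          gcongr
          exact h3.trans (min_le_right _ _)
      _ < ε := by
          rw [div_mul_eq_mul_div, div_lt_iff₀ (by positivity)]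
          nlinarith [norm_nonneg P]
  obtain ⟨a, ha⟩ := cauchySeq_tendsto_of_complete hc
  exact ⟨a, by simpa [HasProd] using ha⟩

theorem StronglyDiscrete.multipliable_expF [CompleteSpace K] {Λ : Set K}
    (h : StronglyDiscrete Λ) (z : K) :
    Multipliable fun l : {l : K // l ∈ Λ ∧ l ≠ 0} => (1 - z / (l : K)) := by
  refine multipliable_one_sub_of_finite_norm_gt _ fun ε hε => ?_
  refine Set.Finite.of_finite_image (f := Subtype.val) ?_ Subtype.val_injective.injOn
  refine (h.finite_norm_le (‖z‖ / ε)).subset ?_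
  rintro _ ⟨⟨l, h1, h2⟩, h3, rfl⟩
  refine ⟨h1, ?_⟩
  simp only [Set.mem_ofPred_eq, norm_div] at h3
  have : 0 < ‖l‖ := norm_pos_iff.mpr h2
  rw [lt_div_iff₀ this] at h3
  rw [le_div_iff₀ hε]
  linarith

/-- `e_Λ(z + λ) = e_Λ(z)` for `λ ∈ Λ`. -/
theorem expF_add_of_mem [CompleteSpace K] {Λ : AddSubgroup K}
    (h : StronglyDiscrete (Λ : Set K)) (z : K) {l : K} (hl : l ∈ Λ) :
    expF (Λ : Set K) (z + l) = expF (Λ : Set K) z := by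
  classical
  let W : ℕ → Finset K := fun n => (h.finite_norm_le n).toFinset
  have hW : ∀ n x, x ∈ W n ↔ x ∈ Λ ∧ ‖x‖ ≤ n := fun n x => by simp [W]
  let p : K → Prop := fun x => x ∈ (Λ : Set K) ∧ x ≠ 0
  let T : ℕ → Finset {x // p x} := fun n => (W n).subtype p
  have hT : Filter.Tendsto T Filter.atTop Filter.atTop := by
    refine Filter.tendsto_atTop_finset_of_monotone (fun a b hab x hx => ?_) fun x => ?_
    · simp only [T, Finset.mem_subtype, hW] at hx ⊢
      exact ⟨hx.1, hx.2.trans (by exact_mod_cast hab)⟩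
    · obtain ⟨n, hn⟩ := exists_nat_ge ‖(x : K)‖
      exact ⟨n, by simp only [T, Finset.mem_subtype, hW]; exact ⟨x.2.1, hn⟩⟩
  have hlim : ∀ y, Filter.Tendsto (fun n => y * ∏ x ∈ T n, (1 - y / (x : K))) Filter.atTop
      (nhds (expF (Λ : Set K) y)) := by
    intro y
    refine Filter.Tendsto.const_mul _ ?_
    have := (h.multipliable_expF y).hasProd
    rw [HasProd, SummationFilter.unconditional_filter] at this
    exact this.comp hT
  have hprod : ∀ y n, y * ∏ x ∈ T n, (1 - y / (x : K)) =
      (∏ x ∈ (W n).erase 0, (-x⁻¹)) * ∏ x ∈ W n, (y - x) := by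
    intro y n
    have h0 : (0 : K) ∈ W n := by simp [hW, Λ.zero_mem]
    have h1 : (W n).filter p = (W n).erase 0 := by
      ext x
      simp only [Finset.mem_filter, Finset.mem_erase, hW, p, SetLike.mem_coe]
      tauto
    rw [Finset.prod_subtype_eq_prod_filter (f := fun x => 1 - y / x), h1,
      ← Finset.mul_prod_erase _ _ h0, sub_zero, mul_left_comm, ← Finset.prod_mul_distrib]
    congr 1
    refine Finset.prod_congr rfl fun x hx => ?_
    have := (Finset.mem_erase.mp hx).1
    field_simp
    ring
  refine tendsto_nhds_unique_of_eventuallyEq (hlim (z + l)) (hlim z) ?_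
  obtain ⟨m, hm⟩ := exists_nat_ge ‖l‖
  filter_upwards [Filter.eventually_ge_atTop m] with n hn
  have hln : ‖l‖ ≤ n := hm.trans (by exact_mod_cast hn)
  rw [hprod, hprod]
  congr 1
  refine Finset.prod_bij' (fun x _ => x - l) (fun x _ => x + l) ?_ ?_ ?_ ?_ ?_
  · intro x hx
    rw [hW] at hx ⊢
    exact ⟨Λ.sub_mem hx.1 hl, (norm_sub_le_max_norm _ _).trans (max_le hx.2 hln)⟩
  · intro x hx
    rw [hW] at hx ⊢
    exact ⟨Λ.add_mem hx.1 hl, (IsUltrametricDist.norm_add_le_max _ _).trans (max_le hx.2 hln)⟩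
  · intros; ring
  · intros; ring
  · intros; ring

end Exponential

section LatticeImage

variable {K : Type*} [NormedField K] {r : ℕ}

/-- If `ω` has entries linearly independent over a complete subfield, then `x ↦ xω` maps strongly
discrete subsets to strongly discrete subsets. -/
theorem StronglyDiscrete.image_rvPair [CompleteSpace K] {Finf : Subfield K}
    (hclosed : IsClosed (Finf : Set K)) (hnt : ∃ x ∈ Finf, 1 < ‖x‖) {L : Set (Fin r → K)}
    (hL : ∀ x ∈ L, ∀ i, x i ∈ Finf) (hLdisc : StronglyDiscrete L) {ω : Fin r → K}
    (hω : ∀ x : Fin r → K, (∀ i, x i ∈ Finf) → rvPair x ω = 0 → x = 0) :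
    StronglyDiscrete ((fun x => rvPair x ω) '' L) := by
  let _ : NontriviallyNormedField Finf :=
    { SubfieldClass.toNormedField Finf with
      non_trivial := by
        obtain ⟨x, hx, h⟩ := hnt
        exact ⟨⟨x, hx⟩, h⟩ }
  let _ : NormedSpace Finf K :=
    { (inferInstance : Module Finf K) with
      norm_smul_le := fun a b => (norm_mul (a : K) b).le }
  have : CompleteSpace Finf := hclosed.completeSpace_coe
  let f : (Fin r → Finf) →ₗ[Finf] K :=
    { toFun := fun x => rvPair (fun i => (x i : K)) ω
      map_add' := fun x y => by simp [rvPair, add_mul, Finset.sum_add_distrib]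
      map_smul' := fun c x => by
        simp [rvPair, mul_assoc, Finset.mul_sum, Subfield.smul_def] }
  have hf : LinearMap.ker f = ⊥ := by
    rw [LinearMap.ker_eq_bot']
    intro x hx
    ext i
    exact congrFun (hω _ (fun i => (x i).2) hx) i
  obtain ⟨c, -, hc⟩ := f.exists_antilipschitzWith hf
  intro B hB
  obtain ⟨b, hb⟩ := isBounded_iff_forall_norm_le.mp hB
  refine ((hLdisc _ (Metric.isBounded_closedBall (x := 0) (r := c * b))).image
    fun x => rvPair x ω).subset ?_
  rintro _ ⟨⟨x, hx, rfl⟩, hxB⟩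
  refine ⟨x, ⟨hx, ?_⟩, rfl⟩
  let y : Fin r → Finf := fun i => ⟨x i, hL x hx i⟩
  have h1 := hc.le_mul_dist y 0
  rw [map_zero, dist_zero_right, dist_zero_right] at h1
  have h2 : ‖f y‖ ≤ b := hb _ hxB
  have h3 : ‖x‖ = ‖y‖ := rfl
  rw [mem_closedBall_zero_iff, h3]
  exact h1.trans (by gcongr)

end LatticeImage

section Torsion

open Submodule

theorem cardQuot_mul_of_infinite {S : Type*} [CommRing S] [IsDedekindDomain S] [Infinite S]
    (I J : Ideal S) : cardQuot (I * J) = cardQuot I * cardQuot J :=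
  UniqueFactorizationMonoid.multiplicative_of_coprime cardQuot I J (cardQuot_bot _ _)
    (fun {I J} hI => by simp [Ideal.isUnit_iff.mp hI, Ideal.mul_top])
    (fun {I} i hI =>
      have : Ideal.IsPrime I := Ideal.isPrime_of_prime hI
      cardQuot_pow_of_prime hI.ne_zero)
    fun {I J} hIJ => cardQuot_mul_of_coprime <| Ideal.isCoprime_iff_sup_eq.mpr
      (Ideal.isUnit_iff.mp
        (hIJ (Ideal.dvd_iff_le.mpr le_sup_left) (Ideal.dvd_iff_le.mpr le_sup_right)))

variable {A K : Type*} [CommRing A] [Field K] [Algebra A K]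

theorem mk_mem_torsionBySet_iff {M : Type*} [AddCommGroup M] [Module A M] (S : Submodule A M)
    (N : Ideal A) (x : M) :
    (Submodule.Quotient.mk x : M ⧸ S) ∈ torsionBySet A (M ⧸ S) (N : Set A) ↔
      ∀ b ∈ N, b • x ∈ S := by
  simp [mem_torsionBySet_iff, ← Submodule.Quotient.mk_smul, Submodule.Quotient.mk_eq_zero]

/-- `N⁻¹A/A` and `A/N` have the same number of elements. -/
theorem card_torsionBySet_quotient_one [IsDedekindDomain A] [FaithfulSMul A K] [Infinite A]
    (hfin : ∀ I : Ideal A, I ≠ ⊥ → Finite (A ⧸ I)) (N : Ideal A) (hN : N ≠ ⊥) :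
    Nat.card (torsionBySet A (K ⧸ (1 : Submodule A K)) (N : Set A)) = Nat.card (A ⧸ N) := by
  obtain ⟨d, hdN, hd⟩ := Submodule.exists_mem_ne_zero_of_ne_bot hN
  have hdK : algebraMap A K d ≠ 0 := by
    simpa using hd
  obtain ⟨N', hN'⟩ : N ∣ Ideal.span {d} :=
    Ideal.dvd_iff_le.mpr ((Ideal.span_singleton_le_iff_mem _).mpr hdN)
  have hspan : Ideal.span {d} ≠ ⊥ := by simpa using hd
  have hN'0 : N' ≠ ⊥ := by
    rintro rfl
    exact hspan (by simpa using hN')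
  let φ : A →ₗ[A] K ⧸ (1 : Submodule A K) :=
    (mkQ 1).comp (LinearMap.toSpanSingleton A K (algebraMap A K d)⁻¹)
  have hφ : ∀ a, φ a = Submodule.Quotient.mk (algebraMap A K a / algebraMap A K d) := by
    intro a
    simp [φ, Algebra.smul_def, div_eq_mul_inv]
  have hdiv : ∀ a, algebraMap A K a / algebraMap A K d ∈ (1 : Submodule A K) ↔
      a ∈ Ideal.span {d} := by
    intro a
    rw [Submodule.mem_one, Ideal.mem_span_singleton']
    refine exists_congr fun b => ?_
    rw [eq_div_iff hdK, ← map_mul, (FaithfulSMul.algebraMap_injective A K).eq_iff]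
  have hker : LinearMap.ker φ = Ideal.span {d} := by
    ext a
    rw [LinearMap.mem_ker, hφ, Submodule.Quotient.mk_eq_zero, hdiv]
  have himage : torsionBySet A (K ⧸ (1 : Submodule A K)) (N : Set A) = Submodule.map φ N' := by
    ext q
    obtain ⟨z, rfl⟩ := Submodule.Quotient.mk_surjective _ q
    rw [mk_mem_torsionBySet_iff, Submodule.mem_map]
    constructor
    · intro h
      obtain ⟨a, ha⟩ := Submodule.mem_one.mp (h d hdN)
      have hz : z = algebraMap A K a / algebraMap A K d := by
        rw [ha, Algebra.smul_def, mul_div_cancel_left₀ _ hdK]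
      refine ⟨a, ?_, by rw [hφ, hz]⟩
      have : N * Ideal.span {a} ≤ N * N' := by
        rw [← hN', Ideal.mul_le]
        intro b hb c hc
        obtain ⟨e, rfl⟩ := Ideal.mem_span_singleton'.mp hc
        rw [← hdiv]
        have := (1 : Submodule A K).smul_mem e (h b hb)
        convert this using 1
        rw [hz, Algebra.smul_def, Algebra.smul_def, map_mul, map_mul]
        ring
      rw [← Ideal.dvd_iff_le] at this
      have := Ideal.dvd_iff_le.mp ((mul_dvd_mul_iff_left hN).mp this)
      exact this (Ideal.mem_span_singleton_self a)
    · rintro ⟨a, ha, h⟩ b hb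
      rw [hφ, eq_comm, Submodule.Quotient.eq] at h
      have h1 : b • (algebraMap A K a / algebraMap A K d) ∈ (1 : Submodule A K) := by
        rw [Algebra.smul_def, ← mul_div_assoc, ← map_mul, hdiv, hN']
        exact Ideal.mul_mem_mul hb ha
      have h2 := Submodule.smul_mem _ b h
      rw [smul_sub] at h2
      exact (Submodule.sub_mem_iff_left _ h1).mp h2
  have hle : Ideal.span {d} ≤ N' := hN' ▸ Ideal.mul_le_right
  have hcard : Nat.card (Submodule.map φ N') = Nat.card (Submodule.map (mkQ (Ideal.span {d})) N') := by
    let ψ : A ⧸ Ideal.span {d} →ₗ[A] K ⧸ (1 : Submodule A K) := (Ideal.span {d}).liftQ φ hker.ge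
    have hψ : Function.Injective ψ := by
      rw [← LinearMap.ker_eq_bot]
      exact ker_liftQ_eq_bot _ _ _ hker.le
    have : Submodule.map φ N' = (Submodule.map (mkQ (Ideal.span {d})) N').map ψ := by
      rw [← Submodule.map_comp, liftQ_mkQ]
    rw [this]
    exact (Nat.card_congr (equivMapOfInjective ψ hψ _).toEquiv).symm
  rw [himage, hcard]
  have h1 := card_quotient_mul_card_quotient N' (Ideal.span {d}) hle
  have h2 := cardQuot_mul_of_infinite N N'
  rw [← hN', cardQuot_apply, cardQuot_apply, cardQuot_apply, ← h1] at h2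
  have := hfin N' hN'0
  exact Nat.eq_of_mul_eq_mul_right Nat.card_pos h2

/-- The map on `N`-torsion in quotients induced by a linear map. -/
def torsionMap {M M' : Type*} [AddCommGroup M] [Module A M] [AddCommGroup M'] [Module A M']
    (N : Ideal A) {S : Submodule A M} {S' : Submodule A M'} (φ : M →ₗ[A] M')
    (h : S ≤ S'.comap φ) :
    torsionBySet A (M ⧸ S) (N : Set A) →ₗ[A] torsionBySet A (M' ⧸ S') (N : Set A) :=
  (S.mapQ S' φ h).restrict fun x hx => by
    rw [mem_torsionBySet_iff] at hx ⊢
    intro a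
    rw [← map_smul, hx a, map_zero]

theorem coe_torsionMap {M M' : Type*} [AddCommGroup M] [Module A M] [AddCommGroup M']
    [Module A M'] {N : Ideal A} {S : Submodule A M} {S' : Submodule A M'} {φ : M →ₗ[A] M'}
    {h : S ≤ S'.comap φ} {v : torsionBySet A (M ⧸ S) (N : Set A)} {x : M}
    (hv : (v : M ⧸ S) = Submodule.Quotient.mk x) :
    (torsionMap N φ h v : M' ⧸ S') = Submodule.Quotient.mk (φ x) := by
  simp [torsionMap, hv]

theorem LinearMap.det_one_add_comp_comm {k V W : Type*} [Field k] [AddCommGroup V] [Module k V]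
    [AddCommGroup W] [Module k W] [FiniteDimensional k V] [FiniteDimensional k W]
    (f : V →ₗ[k] W) (g : W →ₗ[k] V) :
    LinearMap.det (1 + f ∘ₗ g) = LinearMap.det (1 + g ∘ₗ f) := by
  let b := Module.finBasis k V
  let c := Module.finBasis k W
  rw [← LinearMap.det_toMatrix b, ← LinearMap.det_toMatrix c, map_add, map_add,
    LinearMap.toMatrix_comp c b c, LinearMap.toMatrix_comp b c b, LinearMap.toMatrix_one,
    LinearMap.toMatrix_one, Matrix.det_one_add_mul_comm]

/-- The determinant over `k` of an `A`-valued matrix acting on `Xⁿ`, when its determinant over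
`A` is a scalar of `k`. -/
theorem det_of_apply_eq_sum_smul {k X n : Type*} [Field k] [Algebra k A] [AddCommGroup X]
    [Module A X] [Module k X] [IsScalarTower k A X] [FiniteDimensional k X] [Fintype n]
    [DecidableEq n] (G : Matrix n n A) {δ : k} (hδ : algebraMap k A δ = G.det)
    (T : (n → X) →ₗ[k] (n → X)) (hT : ∀ x j, T x j = ∑ i, G i j • x i) :
    LinearMap.det T = δ ^ Module.finrank k X := by
  classical
  let b := Module.finBasis k X
  let f : A →+* Matrix (Fin (Module.finrank k X)) (Fin (Module.finrank k X)) k :=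
    ((LinearMap.toMatrixAlgEquiv b).toAlgHom.comp (Algebra.lsmul k k X)).toRingHom
  have hf : ∀ a i j, f a i j = b.repr (a • b j) i := by
    intro a i j
    simp [f, LinearMap.toMatrixAlgEquiv_apply]
  let B := (Pi.basis fun _ : n => b).reindex (Equiv.sigmaEquivProd n _)
  have hTB : LinearMap.toMatrix B B T = Matrix.comp n n _ _ k (G.transpose.map f) := by
    ext ⟨j, p⟩ ⟨i, q⟩
    have h1 : B (i, q) = Pi.single i (b q) := by simp [B]
    rw [LinearMap.toMatrix_apply, h1]
    have h2 : ∀ y : n → X, B.repr y (j, p) = b.repr (y j) p := by intro y; simp [B]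
    rw [h2, hT, Finset.sum_eq_single i]
    · simp [hf]
    · intro l _ hl
      simp [Pi.single_eq_of_ne hl]
    · simp
  rw [← LinearMap.det_toMatrix B, hTB, ← Matrix.det_det, Matrix.det_transpose, ← hδ]
  have : f (algebraMap k A δ) = algebraMap k _ δ :=
    ((LinearMap.toMatrixAlgEquiv b).toAlgHom.comp (Algebra.lsmul k k X)).commutes δ
  rw [this, Algebra.algebraMap_eq_smul_one, Matrix.det_smul]
  simp

/-- The determinant of `γ` acting on a lattice `L` that is a direct summand of `Aⁿ` (through
`B` and `C`) is the determinant of a matrix over `A`. -/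
theorem exists_map_eq_one_add_mul {m n : Type*} [Fintype m] [DecidableEq m] [Fintype n]
    [DecidableEq n] {L : Submodule A (m → K)} {B : Matrix n m K} {C : Matrix m n K}
    (hB : ∀ i, B i ∈ L) (hC : ∀ x ∈ L, ∀ j, Matrix.vecMul x C j ∈ (1 : Submodule A K))
    {γ : Matrix m m K} (hγ : ∀ x ∈ L, Matrix.vecMul x γ ∈ L) :
    ∃ G : Matrix n n A, (algebraMap A K).mapMatrix G = 1 + B * ((γ - 1) * C) := by
  have h : ∀ i j, ∃ a, algebraMap A K a = (1 + B * ((γ - 1) * C) : Matrix n n K) i j := by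
    intro i j
    have h1 : (1 : Matrix n n K) i j ∈ (1 : Submodule A K) := by
      rw [Matrix.one_apply]
      split_ifs
      · exact Submodule.mem_one.mpr ⟨1, map_one _⟩
      · exact Submodule.zero_mem _
    have h2 : (B * ((γ - 1) * C) : Matrix n n K) i j ∈ (1 : Submodule A K) := by
      have : (B * ((γ - 1) * C) : Matrix n n K) i j =
          Matrix.vecMul (Matrix.vecMul (B i) γ - B i) C j := by
        rw [← Matrix.mul_assoc, Matrix.mul_sub, Matrix.mul_one]
        simp only [Matrix.mul_apply_eq_vecMul]
        rfl
      rw [this]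
      exact hC _ (L.sub_mem (hγ _ (hB i)) (hB i)) j
    exact Submodule.mem_one.mp (Submodule.add_mem _ h1 h2)
  choose G hG using h
  exact ⟨Matrix.of G, by ext i j; simp [hG]⟩

theorem algebraMap_det_eq {m n : Type*} [Fintype m] [DecidableEq m] [Fintype n]
    [DecidableEq n] {B : Matrix n m K} {C : Matrix m n K} (hCB : C * B = 1)
    {γ : Matrix m m K} {G : Matrix n n A}
    (hG : (algebraMap A K).mapMatrix G = 1 + B * ((γ - 1) * C)) :
    algebraMap A K G.det = γ.det := by
  rw [RingHom.map_det, hG, Matrix.det_one_add_mul_comm, Matrix.mul_assoc, hCB, Matrix.mul_one,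
    add_sub_cancel]

/-- The determinant over `k` of `γ` acting on `N⁻¹L/L`. -/
theorem det_torsionMap_vecMul {k m n : Type*} [Field k] [Algebra k A] [Algebra k K]
    [IsScalarTower k A K] [FaithfulSMul A K]
    [Fintype m] [DecidableEq m] [Fintype n] [DecidableEq n] {L : Submodule A (m → K)}
    {B : Matrix n m K} {C : Matrix m n K} (hCB : C * B = 1)
    (hB : ∀ i, B i ∈ L) (hC : ∀ x ∈ L, ∀ j, Matrix.vecMul x C j ∈ (1 : Submodule A K))
    {γ : Matrix m m K} (hγ : ∀ x ∈ L, Matrix.vecMul x γ ∈ L) (N : Ideal A)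
    [FiniteDimensional k (torsionBySet A (K ⧸ (1 : Submodule A K)) (N : Set A))]
    {δ : k} (hδ : algebraMap k K δ = γ.det)
    (g : torsionBySet A ((m → K) ⧸ L) (N : Set A) →ₗ[A] torsionBySet A ((m → K) ⧸ L) (N : Set A))
    (hg : ∀ (v : torsionBySet A ((m → K) ⧸ L) (N : Set A)) (x : m → K),
      (v : (m → K) ⧸ L) = Submodule.Quotient.mk x →
      (g v : (m → K) ⧸ L) = Submodule.Quotient.mk (Matrix.vecMul x γ)) :
    FiniteDimensional k (torsionBySet A ((m → K) ⧸ L) (N : Set A)) ∧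
    LinearMap.det (g.restrictScalars k) =
      δ ^ Module.finrank k (torsionBySet A (K ⧸ (1 : Submodule A K)) (N : Set A)) := by
  classical
  obtain ⟨G, hG⟩ := exists_map_eq_one_add_mul hB hC hγ
  have hGdet : algebraMap k A δ = G.det := by
    apply FaithfulSMul.algebraMap_injective A K
    rw [algebraMap_det_eq hCB hG, ← hδ, ← IsScalarTower.algebraMap_apply]
  let V := torsionBySet A ((m → K) ⧸ L) (N : Set A)
  let X := torsionBySet A (K ⧸ (1 : Submodule A K)) (N : Set A)
  have hs : ∀ j, L ≤ (1 : Submodule A K).comap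
      ((LinearMap.proj j ∘ₗ Matrix.vecMulLinear C).restrictScalars A) := fun j x hx => hC x hx j
  have hp : ∀ i, (1 : Submodule A K) ≤ L.comap
      ((LinearMap.toSpanSingleton K (m → K) (B i)).restrictScalars A) := by
    intro i z hz
    obtain ⟨a, rfl⟩ := Submodule.mem_one.mp hz
    simpa using L.smul_mem a (hB i)
  let s : V →ₗ[A] (n → X) := LinearMap.pi fun j => torsionMap N _ (hs j)
  let p : (n → X) →ₗ[A] V := ∑ i, torsionMap N _ (hp i) ∘ₗ LinearMap.proj i
  have hs_apply : ∀ (v : V) x, (v : (m → K) ⧸ L) = Submodule.Quotient.mk x → ∀ j,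
      (s v j : K ⧸ (1 : Submodule A K)) = Submodule.Quotient.mk (Matrix.vecMul x C j) :=
    fun v x hv j => coe_torsionMap hv
  have hp_apply : ∀ (x : n → X) (z : n → K),
      (∀ i, (x i : K ⧸ (1 : Submodule A K)) = Submodule.Quotient.mk (z i)) →
      (p x : (m → K) ⧸ L) = Submodule.Quotient.mk (Matrix.vecMul z B) := by
    intro x z hz
    have h1 : Matrix.vecMul z B = ∑ i, z i • B i := by
      ext l
      simp [Matrix.vecMul, dotProduct]
    rw [h1, ← Submodule.mkQ_apply, map_sum]
    simp only [p, LinearMap.sum_apply, Submodule.coe_sum]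
    exact Finset.sum_congr rfl fun i _ => coe_torsionMap (hz i)
  have hps : p ∘ₗ s = LinearMap.id := by
    ext v
    obtain ⟨x, hx⟩ := Submodule.Quotient.mk_surjective _ (v : (m → K) ⧸ L)
    rw [LinearMap.comp_apply, hp_apply _ _ (hs_apply v x hx.symm), Matrix.vecMul_vecMul, hCB,
      Matrix.vecMul_one, hx]
    rfl
  have hsinj : Function.Injective (s.restrictScalars k) :=
    Function.LeftInverse.injective (g := p) fun v => LinearMap.congr_fun hps v
  have hV : FiniteDimensional k V := FiniteDimensional.of_injective _ hsinj
  refine ⟨hV, ?_⟩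
  let f := (s ∘ₗ (g - LinearMap.id)).restrictScalars k
  have h1 := LinearMap.det_one_add_comp_comm f (p.restrictScalars k)
  have h2 : (1 + p.restrictScalars k ∘ₗ f) = g.restrictScalars k := by
    ext v : 1
    have : p (s (g v - v)) = g v - v := LinearMap.congr_fun hps _
    change v + p (s (g v - v)) = g v
    rw [this, add_sub_cancel]
  rw [← h2, ← h1]
  refine det_of_apply_eq_sum_smul G hGdet _ fun x j => ?_
  apply Subtype.ext
  choose z hz using fun i => Submodule.Quotient.mk_surjective _ (x i : K ⧸ (1 : Submodule A K))
  have hpx := hp_apply x z fun i => (hz i).symm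
  have h3 : ((g - LinearMap.id : V →ₗ[A] V) (p x)).1 = Submodule.Quotient.mk
      (Matrix.vecMul (Matrix.vecMul z B) γ - Matrix.vecMul z B) := by
    rw [Submodule.Quotient.mk_sub, ← hg _ _ hpx, ← hpx]
    rfl
  have h4 := hs_apply _ _ h3 j
  have h5 : (((1 + f ∘ₗ p.restrictScalars k) x j : X) : K ⧸ (1 : Submodule A K)) =
      (x j).1 + (s ((g - LinearMap.id : V →ₗ[A] V) (p x)) j).1 := rfl
  rw [h5, h4, ← hz, ← Submodule.Quotient.mk_add]
  have h6 : z j + Matrix.vecMul (Matrix.vecMul (Matrix.vecMul z B) γ - Matrix.vecMul z B) C j =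
      ∑ i, G i j • z i := by
    have : Matrix.vecMul z ((algebraMap A K).mapMatrix G) j = ∑ i, G i j • z i := by
      simp [Matrix.vecMul, dotProduct, Algebra.smul_def, mul_comm]
    rw [← this, hG, Matrix.vecMul_add, Matrix.vecMul_one, ← Matrix.mul_assoc, Matrix.mul_sub,
      Matrix.mul_one, ← Matrix.vecMul_vecMul, Matrix.vecMul_sub, Matrix.vecMul_vecMul]
    rfl
  rw [h6, ← Submodule.mkQ_apply, map_sum]
  simp only [Submodule.coe_sum, Submodule.coe_smul, map_smul, ← hz, Submodule.mkQ_apply]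

end Torsion

section Splitting

/-- A lattice `L` over a Dedekind domain is a direct summand of some `Aⁿ`; the inclusion and the
projection are given by matrices. -/
theorem exists_matrix_splitting {A K m : Type*} [CommRing A] [IsDedekindDomain A] [Field K]
    [Algebra A K] [FaithfulSMul A K] [Fintype m] [DecidableEq m] (L : Submodule A (m → K))
    (hfg : L.FG) {d : A} (hd : d ≠ 0)
    (hspan : ∀ i, Pi.single i (algebraMap A K d) ∈ L)
    (hfrac : ∀ x ∈ L, ∀ i, ∃ a c : A, c ≠ 0 ∧ algebraMap A K c * x i = algebraMap A K a) :
    ∃ (n : ℕ) (B : Matrix (Fin n) m K) (C : Matrix m (Fin n) K), C * B = 1 ∧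
      (∀ i, B i ∈ L) ∧
      ∀ x ∈ L, ∀ j, Matrix.vecMul x C j ∈ (1 : Submodule A K) := by
  have hdK : algebraMap A K d ≠ 0 := by simpa using hd
  have : Module.Finite A L := Module.Finite.iff_fg.mpr hfg
  have : Module.FinitePresentation A L := Module.finitePresentation_of_finite A L
  have : Module.Projective A L := Module.Flat.projective_of_finitePresentation
  obtain ⟨n, p, hp⟩ := Module.Finite.exists_fin' A L
  obtain ⟨s, hs⟩ := p.exists_rightInverse_of_surjective (LinearMap.range_eq_top.mpr hp)
  let B : Matrix (Fin n) m K := Matrix.of fun j => (p (Pi.single j 1) : m → K)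
  let e : m → L := fun i => ⟨_, hspan i⟩
  let C : Matrix m (Fin n) K :=
    Matrix.of fun i j => algebraMap A K (s (e i) j) / algebraMap A K d
  have hsC : ∀ x : L, Matrix.vecMul x.1 C = fun j => algebraMap A K (s x j) := by
    intro x
    choose a c hc hac using hfrac x.1 x.2
    have hcK : ∀ i, algebraMap A K (c i) ≠ 0 := fun i => by simpa using hc i
    have hprod : (∏ i, algebraMap A K (c i)) ≠ 0 := Finset.prod_ne_zero_iff.mpr fun i _ => hcK i
    have hx : ((∏ i, c i) * d) • x = ∑ i, (a i * ∏ l ∈ Finset.univ.erase i, c l) • e i := by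
      ext l
      rw [Submodule.coe_sum]
      simp only [Submodule.coe_smul, e, Finset.sum_apply, Pi.smul_apply, Pi.single_apply,
        smul_ite, smul_zero, Finset.sum_ite_eq, Finset.mem_univ, if_true]
      simp only [Algebra.smul_def, map_mul]
      rw [← Finset.mul_prod_erase _ _ (Finset.mem_univ l), map_mul, ← hac]
      ring
    have hsx := congrArg s hx
    rw [map_smul, map_sum] at hsx
    ext j
    have hj := congrArg (algebraMap A K) (congrFun hsx j)
    simp only [Pi.smul_apply, smul_eq_mul, map_mul, map_prod, map_smul, Finset.sum_apply,
      map_sum] at hj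
    apply mul_left_cancel₀ (mul_ne_zero hprod hdK)
    rw [hj, Matrix.vecMul, dotProduct, Finset.mul_sum]
    refine Finset.sum_congr rfl fun i _ => ?_
    rw [← hac, ← Finset.mul_prod_erase _ _ (Finset.mem_univ i)]
    simp only [C, Matrix.of_apply]
    field_simp
  have hpB : ∀ z : Fin n → A, (p z : m → K) = Matrix.vecMul (fun j => algebraMap A K (z j)) B := by
    intro z
    conv_lhs => rw [pi_eq_sum_univ' z]
    rw [map_sum, Submodule.coe_sum]
    ext l
    simp only [map_smul, Submodule.coe_smul, Finset.sum_apply, Pi.smul_apply, Matrix.vecMul,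
      dotProduct]
    simp only [Algebra.smul_def, B, Matrix.of_apply]
  refine ⟨n, B, C, ?_, fun i => (p (Pi.single i 1)).2, fun x hx j => ?_⟩
  · ext i l
    have h1 : Matrix.vecMul (e i).1 (C * B) = (e i).1 := by
      rw [← Matrix.vecMul_vecMul, hsC, ← hpB]
      exact congrArg Subtype.val (LinearMap.congr_fun hs (e i))
    have h2 := congrFun h1 l
    simp only [e, Matrix.single_vecMul, Pi.smul_apply, smul_eq_mul] at h2
    apply mul_left_cancel₀ hdK
    rw [Matrix.row_apply] at h2
    rw [h2, Matrix.one_apply, Pi.single_apply]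
    simp [eq_comm]
  · rw [hsC ⟨x, hx⟩]
    exact Submodule.mem_one.mpr ⟨_, rfl⟩

end Splitting

section ProductFormula

/-- The product formula for `γ` acting on representatives of the lines of `N⁻¹L/L`. -/
theorem prod_expF_rvPair_vecMul {k A K : Type*} [Field k] [Finite k] [CommRing A] [Algebra k A]
    [NontriviallyNormedField K] [IsUltrametricDist K] [CompleteSpace K] [Algebra A K] [Algebra k K]
    [IsScalarTower k A K] [FaithfulSMul A K] {r : ℕ} {L : Submodule A (Fin r → K)} {n : ℕ}
    {B : Matrix (Fin n) (Fin r) K} {C : Matrix (Fin r) (Fin n) K} (hCB : C * B = 1)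
    (hB : ∀ i, B i ∈ L) (hC : ∀ x ∈ L, ∀ j, Matrix.vecMul x C j ∈ (1 : Submodule A K))
    {γ : Matrix (Fin r) (Fin r) K} (hγ : ∀ x ∈ L, Matrix.vecMul x γ ∈ L) (N : Ideal A)
    [FiniteDimensional k (Submodule.torsionBySet A (K ⧸ (1 : Submodule A K)) (N : Set A))]
    {δ : k} (hδ : algebraMap k K δ = γ.det) (hδ0 : δ ≠ 0) {ω : Fin r → K}
    (hω : StronglyDiscrete ((fun x => rvPair x ω) '' (L : Set (Fin r → K))))
    (R : Finset (Fin r → K)) (hRsub : ∀ w ∈ R, (∀ b ∈ N, b • w ∈ L) ∧ w ∉ L)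
    (hRrep : ∀ x : Fin r → K, (∀ b ∈ N, b • x ∈ L) → x ∉ L →
      ∃! y, y ∈ R ∧ ∃ c : k, c ≠ 0 ∧ x - c • y ∈ L) :
    ∏ w ∈ R, expF ((fun x => rvPair x ω) '' L) (rvPair (Matrix.vecMul w γ) ω) =
      γ.det ^ Module.finrank k
          (Submodule.torsionBySet A (K ⧸ (1 : Submodule A K)) (N : Set A)) *
        ∏ w ∈ R, expF ((fun x => rvPair x ω) '' L) (rvPair w ω) := by
  classical
  let V := Submodule.torsionBySet A ((Fin r → K) ⧸ L) (N : Set A)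
  have hmem := mk_mem_torsionBySet_iff L N
  have hadd : ∀ x y : Fin r → K, rvPair (x + y) ω = rvPair x ω + rvPair y ω := fun x y => by
    simp [rvPair, add_mul, Finset.sum_add_distrib]
  have hsmul : ∀ (c : k) (x : Fin r → K), rvPair (c • x) ω = algebraMap k K c * rvPair x ω :=
    fun c x => by simp [rvPair, Algebra.smul_def, mul_assoc, Finset.mul_sum]
  let Λ : AddSubgroup K := L.toAddSubgroup.map (AddMonoidHom.mk' (fun x => rvPair x ω) hadd)
  let E : (Fin r → K) → K := fun x => expF Λ (rvPair x ω)
  have hE : ∀ x y : Fin r → K, x - y ∈ L → E x = E y := by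
    intro x y hxy
    have : rvPair x ω = rvPair y ω + rvPair (x - y) ω := by rw [← hadd, add_sub_cancel]
    simp only [E]
    rw [this]
    exact expF_add_of_mem (Λ := Λ) hω _ ⟨_, hxy, rfl⟩
  have hkL : ∀ (c : k) (x : Fin r → K), x ∈ L → c • x ∈ L := fun c x hx => by
    rw [← algebraMap_smul A c x]
    exact L.smul_mem _ hx
  have hEsmul : ∀ (c : k) (x : Fin r → K), c ≠ 0 → E (c • x) = algebraMap k K c * E x := by
    intro c x hc
    have hcK : algebraMap k K c ≠ 0 := by simpa using hc
    simp only [E]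
    rw [hsmul]
    refine expF_mul hcK (fun l => ⟨?_, ?_⟩) _
    · rintro ⟨y, hy, h⟩
      refine ⟨c⁻¹ • y, hkL _ _ hy, ?_⟩
      change rvPair y ω = _ at h
      change rvPair (c⁻¹ • y) ω = l
      rw [hsmul, h, map_inv₀, inv_mul_cancel_left₀ hcK]
    · rintro ⟨y, hy, rfl⟩
      exact ⟨c • y, hkL _ _ hy, hsmul c y⟩
  let σ : (Fin r → K) ⧸ L → (Fin r → K) := Function.surjInv (Submodule.Quotient.mk_surjective L)
  have hσ : ∀ v, Submodule.Quotient.mk (σ v) = v := Function.surjInv_eq _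
  have hEσ : ∀ x, E (σ (Submodule.Quotient.mk x)) = E x := fun x =>
    hE _ _ ((Submodule.Quotient.eq L).mp (hσ _))
  have hγL : L ≤ L.comap ((Matrix.vecMulLinear γ).restrictScalars A) := hγ
  let g : V →ₗ[A] V := torsionMap N _ hγL
  have hg : ∀ (v : V) (x : Fin r → K), (v : (Fin r → K) ⧸ L) = Submodule.Quotient.mk x →
      (g v : (Fin r → K) ⧸ L) = Submodule.Quotient.mk (Matrix.vecMul x γ) :=
    fun v x hv => coe_torsionMap hv
  obtain ⟨hV, hdet⟩ := det_torsionMap_vecMul (k := k) hCB hB hC hγ N hδ g hg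
  let u : (Fin r → K) → V := fun w =>
    if h : Submodule.Quotient.mk w ∈ V then ⟨Submodule.Quotient.mk w, h⟩ else 0
  have hu : ∀ w ∈ R, (u w : (Fin r → K) ⧸ L) = Submodule.Quotient.mk w := by
    intro w hw
    have : Submodule.Quotient.mk w ∈ V := (hmem w).mpr (hRsub w hw).1
    simp [u, this]
  have hlines : RepresentsLines k R u := by
    refine ⟨fun w hw h => (hRsub w hw).2 ?_, fun v hv => ?_⟩
    · rw [← Submodule.Quotient.mk_eq_zero L, ← hu w hw, h]
      rfl
    · obtain ⟨x, hx⟩ := Submodule.Quotient.mk_surjective L v.1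
      have hiff : ∀ y ∈ R, (∃ c : k, c ≠ 0 ∧ v = c • u y) ↔ ∃ c : k, c ≠ 0 ∧ x - c • y ∈ L := by
        intro y hy
        refine exists_congr fun c => and_congr_right fun _ => ?_
        rw [← Submodule.Quotient.eq L, hx, Subtype.ext_iff, Submodule.Quotient.mk_smul, ← hu y hy]
        rfl
      have hex := hRrep x ((hmem x).mp (hx ▸ v.2)) fun h => hv <| Subtype.ext <| by
        rw [← hx, (Submodule.Quotient.mk_eq_zero L).mpr h]
        rfl
      refine (existsUnique_congr fun y => ?_).mpr hex
      exact and_congr_right fun hy => hiff y hy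
  have key := hlines.prod_comp_linearMap (g.restrictScalars k)
    (by rw [hdet]; exact pow_ne_zero _ hδ0) (fun v => E (σ v.1)) (fun c v hc => by
      have h : Submodule.Quotient.mk (c • σ v.1) = (c • v).1 := by
        rw [Submodule.Quotient.mk_smul, hσ]
        rfl
      rw [← h, hEσ, hEsmul c _ hc])
  rw [hdet, map_pow, hδ] at key
  have h1 : ∀ w ∈ R, E (σ (g (u w)).1) = E (Matrix.vecMul w γ) := fun w hw => by
    rw [hg _ w (hu w hw), hEσ]
  have h2 : ∀ w ∈ R, E (σ (u w).1) = E w := fun w hw => by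
    rw [hu w hw, hEσ]
  refine (Finset.prod_congr rfl h1).symm.trans (key.trans ?_)
  rw [Finset.prod_congr rfl h2]
  rfl

end ProductFormula

section Lattice

/-- An infinite ring acting on a nonzero strongly discrete subset of `Kʳ` has elements of norm
greater than `1`. -/
theorem exists_one_lt_norm_of_stronglyDiscrete {K : Type*} [NormedField K] {A : Subring K}
    [Infinite A] {r : ℕ} {L : Set (Fin r → K)} (hLA : ∀ a ∈ A, ∀ x ∈ L, a • x ∈ L)
    (hLdisc : StronglyDiscrete L) {x : Fin r → K} (hx : x ∈ L) (hx0 : x ≠ 0) :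
    ∃ a ∈ A, 1 < ‖a‖ := by
  by_contra! h
  have hfin := hLdisc _ (Metric.isBounded_closedBall (x := 0) (r := ‖x‖))
  obtain ⟨i, hi⟩ := Function.ne_iff.mp hx0
  refine Set.infinite_range_of_injective (f := fun a : A => (a : K) • x) (fun a b hab => ?_)
    (hfin.subset ?_)
  · exact Subtype.ext (mul_right_cancel₀ hi (congrFun hab i))
  · rintro _ ⟨a, rfl⟩
    refine ⟨hLA a a.2 x hx, ?_⟩
    rw [mem_closedBall_zero_iff, norm_smul]
    exact mul_le_of_le_one_left (norm_nonneg x) (h a a.2)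

/-- Every vector in the span of `L` over the fraction field has a nonzero `A`-multiple in `L`. -/
theorem exists_smul_mem_of_mem_closure {K : Type*} [Field K] {A : Subring K} {F : Set K}
    (hFrac : ∀ z ∈ F, ∃ a ∈ A, ∃ b ∈ A, b ≠ 0 ∧ z * b = a) {r : ℕ}
    (L : Submodule A (Fin r → K)) {y : Fin r → K}
    (hy : y ∈ AddSubgroup.closure {z | ∃ c ∈ F, ∃ x ∈ (L : Set (Fin r → K)), z = c • x}) :
    ∃ d : A, d ≠ 0 ∧ d • y ∈ L := by
  induction hy using AddSubgroup.closure_induction with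
  | mem z hz =>
    obtain ⟨c, hc, x, hx, rfl⟩ := hz
    obtain ⟨a, ha, b, hb, hb0, h⟩ := hFrac c hc
    refine ⟨⟨b, hb⟩, by simpa [Subtype.ext_iff] using hb0, ?_⟩
    convert L.smul_mem ⟨a, ha⟩ hx using 1
    ext i
    simp only [Pi.smul_apply, Subring.smul_def, smul_eq_mul, ← h]
    ring
  | zero => exact ⟨1, one_ne_zero, by simp⟩
  | add x y _ _ hx hy =>
    obtain ⟨d, hd, hdx⟩ := hx
    obtain ⟨e, he, hey⟩ := hy
    refine ⟨d * e, mul_ne_zero hd he, ?_⟩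
    rw [smul_add]
    refine L.add_mem ?_ ?_
    · rw [mul_comm, mul_smul]
      exact L.smul_mem e hdx
    · rw [mul_smul]
      exact L.smul_mem d hey
  | neg x _ hx =>
    obtain ⟨d, hd, hdx⟩ := hx
    exact ⟨d, hd, by rw [smul_neg]; exact L.neg_mem hdx⟩

theorem exists_single_mem_of_forall_exists_smul {A K m : Type*} [CommRing A] [IsDomain A] [Field K]
    [Algebra A K] [Fintype m] [DecidableEq m] (L : Submodule A (m → K))
    (h : ∀ i, ∃ d : A, d ≠ 0 ∧ d • (Pi.single i 1 : m → K) ∈ L) :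
    ∃ d : A, d ≠ 0 ∧ ∀ i, Pi.single i (algebraMap A K d) ∈ L := by
  choose d hd hdL using h
  refine ⟨∏ i, d i, Finset.prod_ne_zero_iff.mpr fun i _ => hd i, fun i => ?_⟩
  convert L.smul_mem (∏ l ∈ Finset.univ.erase i, d l) (hdL i) using 1
  rw [smul_smul, mul_comm, Finset.mul_prod_erase _ _ (Finset.mem_univ i), ← Pi.single_smul,
    Algebra.algebraMap_eq_smul_one]

theorem infinite_of_ideal_ne_bot_ne_top {A : Type*} [CommRing A] [IsDomain A] {N : Ideal A}
    (hbot : N ≠ ⊥) (htop : N ≠ ⊤) : Infinite A := by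
  by_contra h
  have : Finite A := not_infinite_iff_finite.mp h
  let _ : Field A := (Finite.isField_of_domain A).toField
  exact (eq_bot_or_eq_top N).elim hbot htop

end Lattice

/-- key identity in the proof of Proposition 16.8(b):
`∏_{v∈R} e_{Lω}((vγ)ω) = (det γ)^m · ∏_{v∈R} e_{Lω}(vω)` and `det γ ∈ 𝔽_q`. -/
theorem moore_determinant_identity
    (K : Type*) [NontriviallyNormedField K] [IsUltrametricDist K] [CompleteSpace K]
    [IsAlgClosed K]
    (Finf : Subfield K) (hFinfclosed : IsClosed (Finf : Set K))
    (hFinfloc : LocallyCompactSpace Finf)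
    (Fq : Subfield K) (hFqfin : Finite Fq) (q : ℕ) (hq : Nat.card Fq = q)
    (A : Subring K) (hFqA : (Fq : Set K) ⊆ A)
    (F : Subfield K) (hAF : (A : Set K) ⊆ F) (hFFinf : F ≤ Finf)
    (hDed : IsDedekindDomain A)
    (hFrac : ∀ z ∈ F, ∃ a ∈ A, ∃ b ∈ A, b ≠ 0 ∧ z * b = a)
    (hquot : ∀ I : Ideal A, I ≠ ⊥ → Finite (A ⧸ I))
    -- `A^× = 𝔽_q^×`
    (hunits : ∀ z : K, (∃ u ∈ A, ∃ w ∈ A, u * w = 1 ∧ z = u) ↔ (z ∈ Fq ∧ z ≠ 0))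
    (r : ℕ) (hr : 2 ≤ r)
    (L : Set (Fin r → K))
    (hLsub : ∃ G : AddSubgroup (Fin r → K), (G : Set (Fin r → K)) = L)
    (hLF : ∀ x ∈ L, ∀ i, x i ∈ F)
    (hLA : ∀ a ∈ (A : Set K), ∀ x ∈ L, a • x ∈ L)
    (hLfg : ∃ T : Finset (Fin r → K), (T : Set (Fin r → K)) ⊆ L ∧
      ∀ x ∈ L, x ∈ AddSubgroup.closure
        {y | ∃ a ∈ (A : Set K), ∃ t ∈ (T : Set (Fin r → K)), y = a • t})
    (hLspan : ∀ y : Fin r → K, (∀ i, y i ∈ F) →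
      y ∈ AddSubgroup.closure {z | ∃ c ∈ (F : Set K), ∃ x ∈ L, z = c • x})
    (hLdisc : StronglyDiscrete L)
    (N : Ideal A) (hNne : N ≠ ⊥) (hNpr : N ≠ ⊤)
    (m : ℕ) (hm : Nat.card (A ⧸ N) = q ^ m)
    -- `R` contains exactly one element of each equivalence class of
    -- `v ∼ w ⟺ w ∈ αv + L` for some `α ∈ 𝔽_q^×`
    (R : Finset (Fin r → K))
    (hRsub : (R : Set (Fin r → K)) ⊆ invIdl N L \ L)
    (hRrep : ∀ x ∈ invIdl N L, x ∉ L →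
      ∃! y, y ∈ R ∧ ∃ α : K, α ∈ Fq ∧ α ≠ 0 ∧ x - α • y ∈ L)
    (γ : Matrix (Fin r) (Fin r) K) (hγF : ∀ i j, γ i j ∈ F) (hγdet : γ.det ≠ 0)
    (hγL : (fun x => Matrix.vecMul x γ) '' L = L)
    (ω : Fin r → K)
    (hω : ∀ x : Fin r → K, (∀ i, x i ∈ Finf) → rvPair x ω = 0 → x = 0) :
    γ.det ∈ Fq ∧
    ∏ w ∈ R, expF ((fun x => rvPair x ω) '' L) (rvPair (Matrix.vecMul w γ) ω) =
      γ.det ^ m * ∏ w ∈ R, expF ((fun x => rvPair x ω) '' L) (rvPair w ω) := by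
  classical
  have hker : Fq.toSubring ≤ A := hFqA
  let _ : Algebra Fq A := (Subring.inclusion hker).toAlgebra
  have : IsScalarTower Fq A K := IsScalarTower.of_algebraMap_eq fun _ => rfl
  have : Infinite A := infinite_of_ideal_ne_bot_ne_top hNne hNpr
  obtain ⟨G, hG⟩ := hLsub
  let M : Submodule A (Fin r → K) :=
    { carrier := L
      add_mem' := fun {x y} hx hy => by
        rw [← hG] at hx hy ⊢
        exact G.add_mem hx hy
      zero_mem' := by
        rw [← hG]
        exact G.zero_mem
      smul_mem' := fun a x hx => hLA a a.2 x hx }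
  have hfg : M.FG := by
    obtain ⟨T, hTL, hT⟩ := hLfg
    refine ⟨T, le_antisymm (Submodule.span_le.mpr hTL) fun x hx => ?_⟩
    have h : AddSubgroup.closure {y | ∃ a ∈ (A : Set K), ∃ t ∈ (T : Set (Fin r → K)), y = a • t} ≤
        (Submodule.span A (T : Set (Fin r → K))).toAddSubgroup := by
      rw [AddSubgroup.closure_le]
      rintro _ ⟨a, ha, t, ht, rfl⟩
      exact Submodule.smul_mem _ (⟨a, ha⟩ : A) (Submodule.subset_span ht)
    exact h (hT x hx)
  obtain ⟨d, hd, hdM⟩ := exists_single_mem_of_forall_exists_smul M fun i =>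
    exists_smul_mem_of_mem_closure hFrac M (hLspan (Pi.single i 1) fun j => by
      rw [Pi.single_apply]
      split_ifs
      exacts [F.one_mem, F.zero_mem])
  obtain ⟨n, B, C, hCB, hB, hC⟩ := exists_matrix_splitting M hfg hd hdM fun x hx i => by
    obtain ⟨a, ha, b, hb, hb0, h⟩ := hFrac _ (hLF x hx i)
    exact ⟨⟨a, ha⟩, ⟨b, hb⟩, by simpa [Subtype.ext_iff] using hb0, (mul_comm _ _).trans h⟩
  have hω' : StronglyDiscrete ((fun x => rvPair x ω) '' (M : Set (Fin r → K))) := by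
    have hdK : (d : K) ≠ 0 := by simpa using hd
    obtain ⟨a, ha, h1⟩ := exists_one_lt_norm_of_stronglyDiscrete hLA hLdisc
      (hdM ⟨0, by omega⟩) (by simpa using hdK)
    exact hLdisc.image_rvPair hFinfclosed ⟨a, hFFinf (hAF ha), h1⟩
      (fun x hx i => hFFinf (hLF x hx i)) hω
  have hγM : ∀ x ∈ M, Matrix.vecMul x γ ∈ M := fun x hx => hγL.subset ⟨x, hx, rfl⟩
  have hγunit : IsUnit γ.det := hγdet.isUnit
  have hγM' : ∀ x ∈ M, Matrix.vecMul x γ⁻¹ ∈ M := by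
    intro x hx
    obtain ⟨y, hy, rfl⟩ := hγL.superset hx
    simp only [Matrix.vecMul_vecMul, Matrix.mul_nonsing_inv _ hγunit, Matrix.vecMul_one]
    exact hy
  have hdetA : ∀ γ' : Matrix (Fin r) (Fin r) K, (∀ x ∈ M, Matrix.vecMul x γ' ∈ M) →
      γ'.det ∈ A := by
    intro γ' h
    obtain ⟨G', hG'⟩ := exists_map_eq_one_add_mul hB hC h
    rw [← algebraMap_det_eq hCB hG']
    exact G'.det.2
  have hFq : γ.det ∈ Fq := ((hunits γ.det).mp ⟨_, hdetA γ hγM, _, hdetA _ hγM', by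
    rw [← Matrix.det_mul, Matrix.mul_nonsing_inv _ hγunit, Matrix.det_one], rfl⟩).1
  refine ⟨hFq, ?_⟩
  let X := Submodule.torsionBySet A (K ⧸ (1 : Submodule A K)) (N : Set A)
  have hXcard : Nat.card X = q ^ m := (card_torsionBySet_quotient_one hquot N hNne).trans hm
  have hq1 : 1 < q := hq ▸ Finite.one_lt_card
  have hXfin : Finite X := Nat.finite_of_card_ne_zero (by rw [hXcard]; positivity)
  have hXrank : Module.finrank Fq X = m := by
    have h := Module.natCard_eq_pow_finrank (K := Fq) (V := X)
    rw [hXcard, hq] at h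
    exact (Nat.pow_right_injective hq1 h).symm
  have key := prod_expF_rvPair_vecMul (k := Fq) hCB hB hC hγM N (δ := ⟨γ.det, hFq⟩) rfl
    (fun h => hγdet (congrArg Subtype.val h)) hω' R (fun w hw => hRsub hw) (fun x hx hxL => by
      refine (existsUnique_congr fun y => and_congr_right fun _ => ?_).mpr (hRrep x hx hxL)
      constructor
      · rintro ⟨c, hc, h⟩
        exact ⟨c, c.2, fun h0 => hc (Subtype.ext h0), h⟩
      · rintro ⟨c, hcF, hc, h⟩
        exact ⟨⟨c, hcF⟩, fun h0 => hc (congrArg Subtype.val h0), h⟩)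
  rw [hXrank] at key
  exact key
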